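/- arXiv:2308.12225 — 7 statements merged into one kernel-verified Lean document; each statement's English description precedes it below -/
import Mathlib

section
/- The function F1 is continuously differentiable on ℝ, and its derivative satisfies F1'(s) = −(log(s²)+1)s for 0 < s < δ, F1'(s) = −s(log(δ²)+3) + 2δ for s ≥ δ, F1'(0) = 0, and F1'(−s) = −F1'(s) for all s. -/
open Real Filter

/-- The convex part `F₁` of the decomposition of `(1/2) s² log s²`. -/
noncomputable def F1 (δ : ℝ) : ℝ → ℝ := fun s =>
  if |s| < δ then -(1/2) * s^2 * Real.log (s^2)
  else -(1/2) * s^2 * (Real.log (δ^2) + 3) + 2*δ*|s| - δ^2/2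

/-- The subcritical part `F₂` of the decomposition of `(1/2) s² log s²`. -/
noncomputable def F2 (δ : ℝ) : ℝ → ℝ := fun s =>
  if |s| < δ then 0
  else (1/2) * s^2 * Real.log (s^2/δ^2) + 2*δ*|s| - (3/2)*s^2 - δ^2/2

/-- The derivative of `F1`. -/
noncomputable def F1' (δ : ℝ) : ℝ → ℝ := fun s =>
  if |s| < δ then -(Real.log (s^2) + 1) * s
  else -(Real.log (δ^2) + 3) * s + 2*δ*Real.sign s

/-- The derivative of `F2`. -/
noncomputable def F2' (δ : ℝ) : ℝ → ℝ := fun s =>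
  if |s| ≤ δ then 0
  else s * Real.log (s^2/δ^2) + 2*δ*Real.sign s - 2*s

/-- A function which near `x` always takes one of the values of two functions, agreeing at `x`
together with their derivatives, has that same derivative at `x`. -/
theorem hasDerivAt_of_eventually_eq_or_eq {f g h : ℝ → ℝ} {d x : ℝ}
    (hf : HasDerivAt f d x) (hg : HasDerivAt g d x) (hfx : h x = f x) (hgx : h x = g x)
    (hfg : ∀ᶠ y in nhds x, h y = f y ∨ h y = g y) : HasDerivAt h d x := by
  have h₁ : HasDerivWithinAt h d {y | h y = f y} x :=
    hf.hasDerivWithinAt.congr (fun _ hy => hy) hfx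
  have h₂ : HasDerivWithinAt h d {y | h y = g y} x :=
    hg.hasDerivWithinAt.congr (fun _ hy => hy) hgx
  exact (h₁.union h₂).hasDerivAt hfg

/-- The function `s ↦ -(1/2) s² log s²` is differentiable everywhere, including at `0`. -/
theorem hasDerivAt_neg_half_sq_mul_log_sq (s : ℝ) :
    HasDerivAt (fun t : ℝ => -(1/2) * t^2 * Real.log (t^2)) (-(Real.log (s^2) + 1) * s) s := by
  rcases eq_or_ne s 0 with rfl | hs
  · rw [hasDerivAt_iff_tendsto_slope_zero]
    have h : Tendsto (fun t : ℝ => -(t * Real.log t)) (nhds 0) (nhds 0) := by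
      have h' := (Real.continuous_mul_log.tendsto 0).neg
      rwa [zero_mul, neg_zero] at h'
    simp only [mul_zero]
    refine (h.mono_left nhdsWithin_le_nhds).congr' ?_
    filter_upwards [self_mem_nhdsWithin] with t ht
    have ht' : t ≠ 0 := ht
    simp only [zero_add, Real.log_pow, smul_eq_mul]
    field_simp
    push_cast
    ring
  · have hsq : HasDerivAt (fun t : ℝ => t^2) (2 * s) s := by
      simpa using hasDerivAt_pow 2 s
    have h := (hsq.const_mul (-(1/2))).mul (hsq.log (pow_ne_zero 2 hs))
    refine h.congr_deriv ?_
    field_simp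
    ring

theorem continuous_log_sq_add_one_mul :
    Continuous (fun s : ℝ => -(Real.log (s^2) + 1) * s) := by
  have h : (fun s : ℝ => -(Real.log (s^2) + 1) * s) =
      fun s => -(2 * (s * Real.log s)) - s := by
    funext s
    rw [Real.log_pow]
    push_cast
    ring
  rw [h]
  exact ((Real.continuous_mul_log.const_mul 2).neg).sub continuous_id

theorem F1_of_abs_lt {δ s : ℝ} (hs : |s| < δ) :
    F1 δ s = -(1/2) * s^2 * Real.log (s^2) :=
  if_pos hs

theorem F1_of_le {δ s : ℝ} (hδ : 0 < δ) (hs : δ ≤ s) :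
    F1 δ s = -(1/2) * s^2 * (Real.log (δ^2) + 3) + 2*δ*s - δ^2/2 := by
  have habs : |s| = s := abs_of_pos (hδ.trans_le hs)
  simp only [F1, habs, if_neg hs.not_gt]

theorem F1_neg (δ s : ℝ) : F1 δ (-s) = F1 δ s := by
  simp only [F1, abs_neg, neg_sq]

theorem hasDerivAt_F1_of_abs_lt {δ s : ℝ} (hs : |s| < δ) :
    HasDerivAt (F1 δ) (-(Real.log (s^2) + 1) * s) s :=
  (hasDerivAt_neg_half_sq_mul_log_sq s).congr_of_eventuallyEq <|
    (continuous_abs.continuousAt.eventually_lt continuousAt_const hs).mono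
      fun _ ht => F1_of_abs_lt ht

theorem hasDerivAt_F1_of_le {δ s : ℝ} (hδ : 0 < δ) (hs : δ ≤ s) :
    HasDerivAt (F1 δ) (-s * (Real.log (δ^2) + 3) + 2*δ) s := by
  have hQ : HasDerivAt
      (fun t : ℝ => -(1/2) * t^2 * (Real.log (δ^2) + 3) + 2*δ*t - δ^2/2)
      (-s * (Real.log (δ^2) + 3) + 2*δ) s := by
    have hsq : HasDerivAt (fun t : ℝ => t^2) (2 * s) s := by
      simpa using hasDerivAt_pow 2 s
    refine ((((hsq.const_mul (-(1/2))).mul_const (Real.log (δ^2) + 3)).add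
      ((hasDerivAt_id s).const_mul (2*δ))).sub_const (δ^2/2)).congr_deriv ?_
    ring
  rcases hs.eq_or_lt with rfl | hlt
  · have hP : HasDerivAt (fun t : ℝ => -(1/2) * t^2 * Real.log (t^2))
        (-δ * (Real.log (δ^2) + 3) + 2*δ) δ :=
      (hasDerivAt_neg_half_sq_mul_log_sq δ).congr_deriv (by ring)
    refine hasDerivAt_of_eventually_eq_or_eq hP hQ ?_ (F1_of_le hδ le_rfl) ?_
    · rw [F1_of_le hδ le_rfl]
      ring
    · filter_upwards [lt_mem_nhds hδ] with t ht
      rcases lt_or_ge t δ with h | h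
      · exact Or.inl (F1_of_abs_lt (by rwa [abs_of_pos ht]))
      · exact Or.inr (F1_of_le hδ h)
  · exact hQ.congr_of_eventuallyEq <|
      (lt_mem_nhds hlt).mono fun _ ht => F1_of_le hδ (le_of_lt ht)

theorem F1'_of_abs_lt {δ s : ℝ} (hs : |s| < δ) :
    F1' δ s = -(Real.log (s^2) + 1) * s :=
  if_pos hs

theorem F1'_of_le {δ s : ℝ} (hδ : 0 < δ) (hs : δ ≤ s) :
    F1' δ s = -s * (Real.log (δ^2) + 3) + 2*δ := by
  have hpos : 0 < s := hδ.trans_le hs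
  simp only [F1', abs_of_pos hpos, if_neg hs.not_gt, Real.sign_of_pos hpos]
  ring

theorem F1'_neg (δ s : ℝ) : F1' δ (-s) = -F1' δ s := by
  simp only [F1', abs_neg, neg_sq, Real.sign_neg]
  split_ifs <;> ring

theorem hasDerivAt_F1 {δ : ℝ} (hδ : 0 < δ) (s : ℝ) : HasDerivAt (F1 δ) (F1' δ s) s := by
  rcases lt_or_ge |s| δ with h | h
  · rw [F1'_of_abs_lt h]
    exact hasDerivAt_F1_of_abs_lt h
  rcases le_abs.mp h with h | h
  · rw [F1'_of_le hδ h]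
    exact hasDerivAt_F1_of_le hδ h
  · have hd := (hasDerivAt_F1_of_le hδ h).comp s (hasDerivAt_neg s)
    rw [← F1'_of_le hδ h, F1'_neg, neg_mul_neg, mul_one] at hd
    exact hd.congr_of_eventuallyEq (Eventually.of_forall fun t => (F1_neg δ t).symm)

/-- `F1'` is expressed through the projection of `s` to `[-δ, δ]`. -/
theorem F1'_eq_clamp {δ : ℝ} (hδ : 0 < δ) (s : ℝ) :
    F1' δ s = -(Real.log ((max (-δ) (min δ s))^2) + 1) * max (-δ) (min δ s)
      - (Real.log (δ^2) + 3) * (s - max (-δ) (min δ s)) := by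
  rcases lt_or_ge |s| δ with h | h
  · obtain ⟨h₁, h₂⟩ := abs_lt.mp h
    rw [F1'_of_abs_lt h, min_eq_right h₂.le, max_eq_right h₁.le]
    ring
  rcases le_abs.mp h with h | h
  · rw [F1'_of_le hδ h, min_eq_left h, max_eq_right (by linarith)]
    ring
  · rw [← neg_neg s, F1'_neg, F1'_of_le hδ h, neg_neg, min_eq_right (by linarith),
      max_eq_left (by linarith), neg_sq]
    ring

theorem continuous_F1' {δ : ℝ} (hδ : 0 < δ) : Continuous (F1' δ) := by
  have hc : Continuous fun s : ℝ => max (-δ) (min δ s) := by fun_prop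
  rw [funext (F1'_eq_clamp hδ)]
  exact (continuous_log_sq_add_one_mul.comp hc).sub ((continuous_id.sub hc).const_mul _)

/-- `F1` is continuously differentiable on `ℝ`, with derivative given by the
stated formulas. -/
theorem F1_contDiff (δ : ℝ) (hδ0 : 0 < δ) (hδ : δ < Real.exp (-(3/2))) :
    ∃ g : ℝ → ℝ, Continuous g ∧ (∀ s : ℝ, HasDerivAt (F1 δ) (g s) s) ∧
      (∀ s : ℝ, 0 < s → s < δ → g s = -(Real.log (s^2) + 1) * s) ∧
      (∀ s : ℝ, δ ≤ s → g s = -s * (Real.log (δ^2) + 3) + 2*δ) ∧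
      g 0 = 0 ∧ (∀ s : ℝ, g (-s) = -(g s)) := by
  exact ⟨F1' δ, continuous_F1' hδ0, hasDerivAt_F1 hδ0,
    fun s hs hsδ => F1'_of_abs_lt (by rwa [abs_of_pos hs]),
    fun s hs => F1'_of_le hδ0 hs, by simp [F1', hδ0], F1'_neg δ⟩
end

section
/- The function F2 is continuously differentiable on ℝ, with F2'(s) = 0 for |s| ≤ δ, F2'(s) = s·log(s²/δ²) + 2δ − 2s for s ≥ δ, and F2'(−s) = −F2'(s) for all s; moreover F2 is twice continuously differentiable on the interval (δ, +∞), with F2''(t) = log(t²/δ²) for t > δ. -/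
open Real Filter

/-- Freezing `f` to the left of a critical point `a` preserves differentiability. -/
theorem hasDerivAt_comp_max {f f' : ℝ → ℝ} {a : ℝ} (hf : ∀ t, a ≤ t → HasDerivAt f (f' t) t)
    (ha : f' a = 0) (s : ℝ) : HasDerivAt (fun t => f (max t a)) (f' (max s a)) s := by
  rcases lt_trichotomy s a with h | h | h
  · rw [max_eq_right h.le, ha]
    refine (hasDerivAt_const s (f a)).congr_of_eventuallyEq ?_
    filter_upwards [Iio_mem_nhds h] with t ht
    rw [max_eq_right (le_of_lt ht)]
  · subst h
    have hl : HasDerivWithinAt (fun t => f (max t s)) 0 (Set.Iic s) s :=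
      (hasDerivWithinAt_const s (Set.Iic s) (f s)).congr
        (fun t ht => by rw [max_eq_right ht]) (by rw [max_self])
    have hr : HasDerivWithinAt (fun t => f (max t s)) 0 (Set.Ici s) s :=
      (ha ▸ (hf s le_rfl).hasDerivWithinAt).congr
        (fun t ht => by rw [max_eq_left ht]) (by rw [max_self])
    rw [max_self, ha, ← hasDerivWithinAt_univ, ← Set.Iic_union_Ici (a := s)]
    exact hl.union hr
  · rw [max_eq_left h.le]
    refine (hf s h.le).congr_of_eventuallyEq ?_
    filter_upwards [Ioi_mem_nhds h] with t ht
    rw [max_eq_left (le_of_lt ht)]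

theorem hasDerivAt_log_sq_div_sq {δ t : ℝ} (hδ : δ ≠ 0) (ht : t ≠ 0) :
    HasDerivAt (fun t : ℝ => Real.log (t^2/δ^2)) (2/t) t := by
  have h := (((hasDerivAt_id' t).pow 2).div_const (δ^2)).log (div_ne_zero (pow_ne_zero 2 ht) (pow_ne_zero 2 hδ))
  refine h.congr_deriv ?_
  simp
  field_simp

theorem hasDerivAt_F2_outer_deriv {δ t : ℝ} (hδ : δ ≠ 0) (ht : t ≠ 0) :
    HasDerivAt (fun t : ℝ => t * Real.log (t^2/δ^2) + 2*δ - 2*t) (Real.log (t^2/δ^2)) t := by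
  have h := (((hasDerivAt_id' t).mul (hasDerivAt_log_sq_div_sq hδ ht)).add_const (2*δ)).sub
    ((hasDerivAt_id' t).const_mul 2)
  refine h.congr_deriv ?_
  field_simp
  ring

theorem hasDerivAt_F2_outer {δ t : ℝ} (hδ : δ ≠ 0) (ht : t ≠ 0) :
    HasDerivAt (fun t : ℝ => (1/2) * t^2 * Real.log (t^2/δ^2) + 2*δ*t - (3/2)*t^2 - δ^2/2)
      (t * Real.log (t^2/δ^2) + 2*δ - 2*t) t := by
  have hsq := (hasDerivAt_id' t).pow 2
  have h := ((((hsq.const_mul (1/2)).mul (hasDerivAt_log_sq_div_sq hδ ht)).add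
    ((hasDerivAt_id' t).const_mul (2*δ))).sub (hsq.const_mul (3/2))).sub_const (δ^2/2)
  refine h.congr_deriv ?_
  simp
  field_simp
  ring

/-- `F2` as a sum of two mirrored one-sided functions. -/
theorem F2_eq_add_comp_max {δ : ℝ} (hδ : 0 < δ) {G : ℝ → ℝ}
    (hG : G = fun t => (1/2) * t^2 * Real.log (t^2/δ^2) + 2*δ*t - (3/2)*t^2 - δ^2/2) :
    F2 δ = fun s => G (max s δ) + G (max (-s) δ) := by
  have hGδ : G δ = 0 := by
    rw [hG]
    simp only [div_self (pow_ne_zero 2 hδ.ne'), Real.log_one]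
    ring
  funext s
  unfold F2
  split_ifs with h
  · rw [abs_lt] at h
    rw [max_eq_right h.2.le, max_eq_right (by linarith), hGδ, add_zero]
  · rcases le_total 0 s with hs | hs
    · rw [abs_of_nonneg hs] at h ⊢
      rw [max_eq_left (not_lt.1 h), max_eq_right (by linarith), hGδ, add_zero, hG]
    · rw [abs_of_nonpos hs] at h ⊢
      rw [max_eq_left (not_lt.1 h), max_eq_right (by linarith), hGδ, zero_add, hG]
      simp only [neg_sq]

/-- `F2` is continuously differentiable on `ℝ` with the stated derivative, and
twice continuously differentiable on `(δ, ∞)` with `F2'' t = log (t²/δ²)`. -/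
theorem F2_contDiff (δ : ℝ) (hδ0 : 0 < δ) (hδ : δ < Real.exp (-(3/2))) :
    ∃ g : ℝ → ℝ, Continuous g ∧ (∀ s : ℝ, HasDerivAt (F2 δ) (g s) s) ∧
      (∀ s : ℝ, |s| ≤ δ → g s = 0) ∧
      (∀ s : ℝ, δ ≤ s → g s = s * Real.log (s^2/δ^2) + 2*δ - 2*s) ∧
      (∀ s : ℝ, g (-s) = -(g s)) ∧
      (∀ t : ℝ, δ < t → HasDerivAt g (Real.log (t^2/δ^2)) t) ∧
      ContinuousOn (fun t : ℝ => Real.log (t^2/δ^2)) (Set.Ioi δ) := by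
  obtain ⟨P, hP⟩ : ∃ P : ℝ → ℝ, P = fun t => t * Real.log (t^2/δ^2) + 2*δ - 2*t := ⟨_, rfl⟩
  have hPδ : P δ = 0 := by
    rw [hP]
    simp only [div_self (pow_ne_zero 2 hδ0.ne'), Real.log_one]
    ring
  have hPd : ∀ t, δ ≤ t → HasDerivAt P (Real.log (t^2/δ^2)) t := fun t ht =>
    hP ▸ hasDerivAt_F2_outer_deriv hδ0.ne' (hδ0.trans_le ht).ne'
  have hPouter : ∀ s, δ ≤ s → P (max s δ) - P (max (-s) δ) = P s := fun s hs => by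
    rw [max_eq_left hs, max_eq_right (by linarith), hPδ, sub_zero]
  have hPc : Continuous fun s => P (max s δ) := continuous_iff_continuousAt.2 fun s =>
    (hasDerivAt_comp_max hPd (by simp [hδ0.ne']) s).continuousAt
  refine ⟨fun s => P (max s δ) - P (max (-s) δ), hPc.sub (hPc.comp continuous_neg), ?_, ?_, ?_,
    ?_, ?_, ?_⟩
  · intro s
    have hd := hasDerivAt_comp_max (f' := P) (a := δ)
      (fun t ht => (hasDerivAt_F2_outer hδ0.ne' (hδ0.trans_le ht).ne').congr_deriv (by rw [hP]))
      hPδ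
    rw [F2_eq_add_comp_max hδ0 rfl]
    refine ((hd s).add ((hd (-s)).comp s (hasDerivAt_neg s))).congr_deriv ?_
    ring
  · intro s hs
    rw [abs_le] at hs
    simp only [max_eq_right hs.2, max_eq_right (show -s ≤ δ by linarith), sub_self]
  · intro s hs
    exact (hPouter s hs).trans (by rw [hP])
  · intro s
    simp only [neg_neg, neg_sub]
  · intro t ht
    refine (hPd t ht.le).congr_of_eventuallyEq ?_
    filter_upwards [Ioi_mem_nhds ht] with s hs
    exact hPouter s (le_of_lt hs)
  · intro t ht
    exact (hasDerivAt_log_sq_div_sq hδ0.ne' (hδ0.trans ht).ne').continuousAt.continuousWithinAt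
end

section
/- The function F1 is even, convex on ℝ, nonnegative, vanishes exactly at 0 (i.e. F1(s) = 0 if and only if s = 0), and satisfies s·F1'(s) ≥ 0 for every real s. -/
open Real Filter

/-- The function on the half-line `[0, ∞)` whose even extension is `F1`. -/
noncomputable def radialProfile (δ r : ℝ) : ℝ :=
  if r < δ then -(r * (r * Real.log r))
  else -(r ^ 2 * (Real.log δ + 3 / 2)) + 2 * δ * r - δ ^ 2 / 2

/-- The derivative of `radialProfile` on `(0, ∞)`. -/
noncomputable def radialSlope (δ r : ℝ) : ℝ :=
  if r < δ then -((2 * Real.log r + 1) * r)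
  else -((2 * Real.log δ + 3) * r) + 2 * δ

theorem F1_eq_radialProfile_abs (δ s : ℝ) : F1 δ s = radialProfile δ |s| := by
  unfold F1 radialProfile
  simp only [Real.log_pow, Real.log_abs, sq_abs]
  split_ifs
  · have h : |s| * (|s| * Real.log s) = s ^ 2 * Real.log s := by
      rw [← mul_assoc, ← sq, sq_abs]
    rw [h]
    push_cast
    ring
  · push_cast
    ring

theorem log_lt_of_lt_exp {δ : ℝ} (hδ0 : 0 < δ) (hδ : δ < Real.exp (-(3/2))) :
    Real.log δ < -(3/2) :=
  (Real.log_lt_iff_lt_exp hδ0).2 hδ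

theorem continuous_radialProfile (δ : ℝ) : Continuous (radialProfile δ) := by
  have h : radialProfile δ = fun r => if δ ≤ r then
      -(r ^ 2 * (Real.log δ + 3 / 2)) + 2 * δ * r - δ ^ 2 / 2
      else -(r * (r * Real.log r)) := by
    funext r
    unfold radialProfile
    split_ifs <;> first | rfl | linarith
  rw [h]
  refine Continuous.if_le (by fun_prop) (continuous_id.mul Real.continuous_mul_log).neg
    continuous_const continuous_id ?_
  rintro r rfl
  ring

theorem hasDerivAt_radialProfile {δ r : ℝ} (hr : 0 < r) :
    HasDerivAt (radialProfile δ) (radialSlope δ r) r := by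
  have inner : HasDerivAt (fun r : ℝ => -(r * (r * Real.log r)))
      (-((2 * Real.log r + 1) * r)) r := by
    refine (((hasDerivAt_id r).mul (Real.hasDerivAt_mul_log hr.ne')).neg).congr_deriv ?_
    simp only [id]
    ring
  have outer : HasDerivAt
      (fun r : ℝ => -(r ^ 2 * (Real.log δ + 3 / 2)) + 2 * δ * r - δ ^ 2 / 2)
      (-((2 * Real.log δ + 3) * r) + 2 * δ) r := by
    refine (((((hasDerivAt_pow 2 r).mul_const (Real.log δ + 3 / 2)).neg).add
      ((hasDerivAt_id r).const_mul (2 * δ))).sub_const (δ ^ 2 / 2)).congr_deriv ?_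
    norm_num
    ring
  rcases lt_trichotomy r δ with h | rfl | h
  · rw [radialSlope, if_pos h]
    refine inner.congr_of_eventuallyEq ?_
    filter_upwards [Iio_mem_nhds h] with x hx
    exact if_pos hx
  · rw [radialSlope, if_neg (lt_irrefl r)]
    have left : HasDerivWithinAt (radialProfile r)
        (-((2 * Real.log r + 3) * r) + 2 * r) (Set.Iic r) r := by
      refine (inner.hasDerivWithinAt.congr_deriv (by ring)).congr_of_mem (fun x hx => ?_)
        Set.self_mem_Iic
      rcases (Set.mem_Iic.1 hx).lt_or_eq with h | rfl
      · exact if_pos h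
      · rw [radialProfile, if_neg (lt_irrefl x)]
        ring
    have right : HasDerivWithinAt (radialProfile r)
        (-((2 * Real.log r + 3) * r) + 2 * r) (Set.Ici r) r :=
      outer.hasDerivWithinAt.congr_of_mem (fun x hx => if_neg (not_lt.2 hx)) Set.self_mem_Ici
    simpa [Set.Iic_union_Ici] using left.union right
  · rw [radialSlope, if_neg h.not_gt]
    refine outer.congr_of_eventuallyEq ?_
    filter_upwards [Ioi_mem_nhds h] with x hx
    exact if_neg (not_lt.2 (le_of_lt hx))

theorem two_mul_log_add_one_mul_le {a b : ℝ} (ha : 0 < a) (hab : a ≤ b)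
    (hb : Real.log b ≤ -(3/2)) :
    (2 * Real.log b + 1) * b ≤ (2 * Real.log a + 1) * a := by
  have h := Real.log_le_sub_one_of_pos (div_pos (ha.trans_le hab) ha)
  rw [Real.log_div (ha.trans_le hab).ne' ha.ne'] at h
  have h' : a * (Real.log b - Real.log a) ≤ b - a := by
    calc a * (Real.log b - Real.log a) ≤ a * (b / a - 1) := by gcongr
      _ = b - a := by field_simp
  nlinarith [mul_nonneg (sub_nonneg.2 hab) (sub_nonneg.2 hb)]

theorem monotoneOn_radialSlope {δ : ℝ} (hlog : Real.log δ < -(3/2)) :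
    MonotoneOn (radialSlope δ) (Set.Ioi 0) := by
  intro a ha b hb hab
  rw [Set.mem_Ioi] at ha hb
  unfold radialSlope
  split_ifs with h1 h2 h2
  · have := two_mul_log_add_one_mul_le ha hab ((Real.log_le_log hb h2.le).trans hlog.le)
    linarith
  · have := two_mul_log_add_one_mul_le ha h1.le hlog.le
    nlinarith
  · linarith
  · nlinarith

theorem radialSlope_nonneg {δ r : ℝ} (hδ0 : 0 < δ) (hlog : Real.log δ < -(3/2))
    (hr : 0 < r) : 0 ≤ radialSlope δ r := by
  unfold radialSlope
  split_ifs with h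
  · have := Real.log_le_log hr h.le
    nlinarith
  · nlinarith

theorem radialProfile_pos {δ r : ℝ} (hδ0 : 0 < δ) (hlog : Real.log δ < -(3/2))
    (hr : 0 < r) : 0 < radialProfile δ r := by
  unfold radialProfile
  split_ifs with h
  · have := Real.log_le_log hr h.le
    have := mul_pos (mul_pos hr hr) (show 0 < -Real.log r by linarith)
    linarith
  · have := mul_pos (mul_pos hr hr) (show 0 < -(Real.log δ + 3 / 2) by linarith)
    nlinarith [mul_le_mul_of_nonneg_left (not_lt.1 h) hδ0.le]

theorem radialProfile_zero {δ : ℝ} (hδ0 : 0 < δ) : radialProfile δ 0 = 0 := by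
  simp [radialProfile, hδ0]

theorem convexOn_radialProfile {δ : ℝ} (hlog : Real.log δ < -(3/2)) :
    ConvexOn ℝ (Set.Ici 0) (radialProfile δ) := by
  refine MonotoneOn.convexOn_of_deriv (convex_Ici 0) (continuous_radialProfile δ).continuousOn
    ?_ ?_
  · rw [interior_Ici]
    exact fun x hx => (hasDerivAt_radialProfile hx).differentiableAt.differentiableWithinAt
  · rw [interior_Ici]
    exact (monotoneOn_radialSlope hlog).congr
      fun x hx => (hasDerivAt_radialProfile hx).deriv.symm

theorem monotoneOn_radialProfile {δ : ℝ} (hδ0 : 0 < δ) (hlog : Real.log δ < -(3/2)) :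
    MonotoneOn (radialProfile δ) (Set.Ici 0) := by
  refine monotoneOn_of_deriv_nonneg (convex_Ici 0) (continuous_radialProfile δ).continuousOn
    ?_ ?_
  · rw [interior_Ici]
    exact fun x hx => (hasDerivAt_radialProfile hx).differentiableAt.differentiableWithinAt
  · rw [interior_Ici]
    intro x hx
    rw [(hasDerivAt_radialProfile hx).deriv]
    exact radialSlope_nonneg hδ0 hlog hx

theorem convexOn_F1 {δ : ℝ} (hδ0 : 0 < δ) (hlog : Real.log δ < -(3/2)) :
    ConvexOn ℝ Set.univ (F1 δ) := by
  refine ⟨convex_univ, fun x _ y _ a b ha hb hab => ?_⟩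
  simp only [F1_eq_radialProfile_abs]
  have habs : |a • x + b • y| ≤ a • |x| + b • |y| := by
    simpa [abs_mul, abs_of_nonneg ha, abs_of_nonneg hb] using abs_add_le (a * x) (b * y)
  exact (monotoneOn_radialProfile hδ0 hlog (Set.mem_Ici.2 (abs_nonneg _))
    (Set.mem_Ici.2 ((abs_nonneg _).trans habs)) habs).trans
    ((convexOn_radialProfile hlog).2 (Set.mem_Ici.2 (abs_nonneg x))
      (Set.mem_Ici.2 (abs_nonneg y)) ha hb hab)

theorem mul_F1'_eq (δ s : ℝ) : s * F1' δ s = |s| * radialSlope δ |s| := by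
  have hsign : s * Real.sign s = |s| := by
    rcases lt_trichotomy s 0 with h | rfl | h
    · simp [Real.sign_of_neg h, abs_of_neg h]
    · simp
    · simp [Real.sign_of_pos h, abs_of_pos h]
  unfold F1' radialSlope
  simp only [Real.log_pow, Real.log_abs]
  push_cast
  split_ifs
  · linear_combination (2 * Real.log s + 1) * sq_abs s
  · linear_combination (2 * Real.log δ + 3) * sq_abs s + 2 * δ * hsign

/-- `F1` is even, convex, nonnegative, vanishes exactly at `0`, and
`s * F1' s ≥ 0` for every real `s`. -/
theorem F1_properties (δ : ℝ) (hδ0 : 0 < δ) (hδ : δ < Real.exp (-(3/2))) :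
    (∀ s : ℝ, F1 δ (-s) = F1 δ s) ∧
    ConvexOn ℝ Set.univ (F1 δ) ∧
    (∀ s : ℝ, 0 ≤ F1 δ s) ∧
    (∀ s : ℝ, F1 δ s = 0 ↔ s = 0) ∧
    (∀ s : ℝ, 0 ≤ s * F1' δ s) := by
  have hlog := log_lt_of_lt_exp hδ0 hδ
  have hpos : ∀ s : ℝ, s ≠ 0 → 0 < F1 δ s := fun s hs => by
    rw [F1_eq_radialProfile_abs]
    exact radialProfile_pos hδ0 hlog (abs_pos.2 hs)
  have hzero : F1 δ 0 = 0 := by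
    rw [F1_eq_radialProfile_abs, abs_zero, radialProfile_zero hδ0]
  refine ⟨fun s => ?_, convexOn_F1 hδ0 hlog, fun s => ?_, fun s => ⟨fun h => ?_, ?_⟩, fun s => ?_⟩
  · simp only [F1_eq_radialProfile_abs, abs_neg]
  · rcases eq_or_ne s 0 with rfl | hs
    · exact hzero.ge
    · exact (hpos s hs).le
  · by_contra hs
    exact (hpos s hs).ne' h
  · rintro rfl
    exact hzero
  · rw [mul_F1'_eq]
    rcases eq_or_ne s 0 with rfl | hs
    · simp
    · exact mul_nonneg (abs_nonneg s) (radialSlope_nonneg hδ0 hlog (abs_pos.2 hs))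
end

section
/- There exists a constant l with 1 < l < 2 such that l·F1(s) ≤ F1'(s)·s ≤ 2·F1(s) for every real s ≠ 0. -/
open Real Filter

/-- There is `l ∈ (1,2)` with `l · F1 s ≤ F1' s · s ≤ 2 · F1 s` for all `s ≠ 0`. -/
theorem F1_global_ratio (δ : ℝ) (hδ0 : 0 < δ) (hδ : δ < Real.exp (-(3/2))) :
    ∃ l : ℝ, 1 < l ∧ l < 2 ∧
      ∀ s : ℝ, s ≠ 0 → l * F1 δ s ≤ F1' δ s * s ∧ F1' δ s * s ≤ 2 * F1 δ s := by
  have hL : Real.log (δ ^ 2) < -3 := by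
    have h := (Real.log_lt_iff_lt_exp hδ0).2 hδ
    rw [Real.log_pow]
    push_cast
    linarith
  obtain ⟨A, hA⟩ : ∃ A, A = -(Real.log (δ ^ 2) + 3) := ⟨_, rfl⟩
  have hApos : 0 < A := by linarith
  have hδA : Real.log (δ ^ 2) = -(A + 3) := by linarith
  have hA4 : 0 < 4 + A := by linarith
  refine ⟨(4 + 2 * A) / (4 + A), ?_, ?_, ?_⟩
  · rw [lt_div_iff₀ hA4]; linarith
  · rw [div_lt_iff₀ hA4]; linarith
  intro s hs
  rw [div_mul_eq_mul_div, div_le_iff₀ hA4]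
  by_cases h : |s| < δ
  · simp only [F1, F1', if_pos h]
    have hs2 : 0 < s ^ 2 := by positivity
    have hlog : Real.log (s ^ 2) ≤ -(A + 3) := by
      rw [← hδA]
      exact Real.log_le_log hs2 (sq_le_sq.2 (by rw [abs_of_pos hδ0]; exact h.le))
    constructor
    · nlinarith [mul_nonneg hs2.le (show 0 ≤ -(A + 3) - Real.log (s ^ 2) by linarith)]
    · nlinarith
  · have hδs : δ ≤ |s| := not_lt.1 h
    have hderiv : F1' δ s * s = A * |s| ^ 2 + 2 * δ * |s| := by
      have hsign : Real.sign s * s = |s| := by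
        rcases hs.lt_or_gt with h0 | h0
        · rw [Real.sign_of_neg h0, abs_of_neg h0]; ring
        · rw [Real.sign_of_pos h0, abs_of_pos h0]; ring
      simp only [F1', if_neg h, hδA, sq_abs]
      linear_combination 2 * δ * hsign
    have hval : F1 δ s = A / 2 * |s| ^ 2 + 2 * δ * |s| - δ ^ 2 / 2 := by
      simp only [F1, if_neg h, hδA, sq_abs]
      ring
    rw [hderiv, hval]
    constructor
    · nlinarith [mul_nonneg hApos.le (sq_nonneg (|s| - δ)),
        mul_nonneg hApos.le (sq_nonneg |s|), sq_nonneg δ]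
    · nlinarith
end

section
/- The function F1 satisfies the Δ₂-condition: there exists a constant k > 0 such that F1(2t) ≤ k·F1(t) for every t ≥ 0. -/
open Real Filter

/-- `F1` satisfies the `Δ₂`-condition. -/
theorem F1_delta2 (δ : ℝ) (hδ0 : 0 < δ) (hδ : δ < Real.exp (-(3/2))) :
    ∃ k : ℝ, 0 < k ∧ ∀ t : ℝ, 0 ≤ t → F1 δ (2*t) ≤ k * F1 δ t := by
  have hlog : Real.log (δ ^ 2) < -3 := by
    have h := Real.log_lt_log hδ0 hδ
    rw [Real.log_exp] at h
    rw [Real.log_pow]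
    push_cast
    linarith
  refine ⟨6, by norm_num, fun t ht => ?_⟩
  have ht2 : 0 ≤ 2 * t := by positivity
  simp only [F1, abs_of_nonneg ht, abs_of_nonneg ht2]
  set l := Real.log (δ ^ 2)
  rcases ht.eq_or_lt with rfl | htpos
  · simp [hδ0]
  have hlt : t < δ → Real.log (t ^ 2) ≤ l := fun h =>
    Real.log_le_log (by positivity) (by gcongr)
  split_ifs with h1 h2 h2
  · have hmono : Real.log (t ^ 2) ≤ Real.log ((2 * t) ^ 2) :=
      Real.log_le_log (by positivity) (by nlinarith)
    have hneg : Real.log (t ^ 2) ≤ 0 := by linarith [hlt h2]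
    nlinarith [mul_le_mul_of_nonneg_left hmono (sq_nonneg t),
      mul_nonpos_of_nonneg_of_nonpos (sq_nonneg t) hneg]
  · linarith
  · nlinarith [mul_le_mul_of_nonneg_left (hlt h2) (sq_nonneg t),
      mul_le_mul_of_nonneg_left hlog.le (sq_nonneg t),
      mul_le_mul_of_nonneg_right (not_lt.mp h1) ht, sq_nonneg δ]
  · nlinarith [mul_le_mul_of_nonneg_left hlog.le (sq_nonneg t),
      mul_le_mul_of_nonneg_left (not_lt.mp h2) hδ0.le]
end

section
/- The map s ↦ F2'(s)/s is nondecreasing on (0, +∞) and strictly increasing on (δ, +∞). -/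
open Real Filter

theorem F2'_div_self_of_le {δ s : ℝ} (hs : 0 < s) (hsδ : s ≤ δ) : F2' δ s / s = 0 := by
  simp [F2', abs_of_pos hs, hsδ]

theorem F2'_div_self_of_ge {δ s : ℝ} (hδ : 0 < δ) (hs : δ ≤ s) :
    F2' δ s / s = 2 * Real.log s - 2 * Real.log δ + 2 * (δ / s) - 2 := by
  have hs0 : 0 < s := hδ.trans_le hs
  rcases hs.eq_or_lt with rfl | hlt
  · rw [F2'_div_self_of_le hδ le_rfl, div_self hδ.ne']
    ring
  · rw [F2', abs_of_pos hs0, if_neg hlt.not_ge, Real.sign_of_pos hs0,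
      Real.log_div (by positivity) (by positivity), Real.log_pow, Real.log_pow]
    field_simp
    push_cast
    ring

theorem F2'_div_self_strictMonoOn_Ici {δ : ℝ} (hδ : 0 < δ) :
    StrictMonoOn (fun s : ℝ => F2' δ s / s) (Set.Ici δ) := by
  intro a ha b hb hab
  have ha0 : 0 < a := hδ.trans_le ha
  have hb0 : 0 < b := ha0.trans hab
  simp only [F2'_div_self_of_ge hδ ha, F2'_div_self_of_ge hδ hb]
  have hlog : Real.log a - Real.log b < a / b - 1 := by
    rw [← Real.log_div ha0.ne' hb0.ne']
    exact Real.log_lt_sub_one_of_pos (by positivity) ((div_lt_one hb0).2 hab).ne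
  have hfrac : δ / a - δ / b ≤ 1 - a / b := by
    have h1 : δ / a - δ / b = δ / a * (1 - a / b) := by
      field_simp
    rw [h1]
    exact mul_le_of_le_one_left (sub_nonneg.2 ((div_le_one hb0).2 hab.le)) ((div_le_one ha0).2 ha)
  linarith

/-- `s ↦ F2' s / s` is nondecreasing on `(0, ∞)` and strictly increasing on `(δ, ∞)`. -/
theorem F2'_ratio_monotone (δ : ℝ) (hδ0 : 0 < δ) (hδ : δ < Real.exp (-(3/2))) :
    MonotoneOn (fun s : ℝ => F2' δ s / s) (Set.Ioi 0) ∧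
    StrictMonoOn (fun s : ℝ => F2' δ s / s) (Set.Ioi δ) := by
  have hmono := F2'_div_self_strictMonoOn_Ici hδ0
  refine ⟨?_, hmono.mono Set.Ioi_subset_Ici_self⟩
  have hzero : MonotoneOn (fun s : ℝ => F2' δ s / s) (Set.Ioc 0 δ) := fun a ha b hb _ => by
    simp only [F2'_div_self_of_le ha.1 ha.2, F2'_div_self_of_le hb.1 hb.2, le_refl]
  rw [← Set.Ioc_union_Ici_eq_Ioi hδ0]
  exact hzero.union_right hmono.monotoneOn (isGreatest_Ioc hδ0) isLeast_Ici
end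

section
/- For every real t one has F1(t) − (1/2)F1'(t)·t ≥ 0; equivalently, (1/2)t² + F2(t) − (1/2)F2'(t)·t ≥ 0 for every real t. -/
open Real Filter

theorem sign_mul_self_eq_abs (t : ℝ) : Real.sign t * t = |t| := by
  rcases lt_trichotomy t 0 with h | rfl | h
  · rw [Real.sign_of_neg h, abs_of_neg h, neg_one_mul]
  · simp
  · rw [Real.sign_of_pos h, abs_of_pos h, one_mul]

/-- `F1 t - (1/2) F1' t · t ≥ 0` for all `t`; equivalently
`(1/2) t² + F2 t - (1/2) F2' t · t ≥ 0` for all `t`. -/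
theorem F1_F2_sign (δ : ℝ) (hδ0 : 0 < δ) (hδ : δ < Real.exp (-(3/2))) :
    (∀ t : ℝ, 0 ≤ F1 δ t - (1/2) * F1' δ t * t) ∧
    (∀ t : ℝ, 0 ≤ (1/2) * t^2 + F2 δ t - (1/2) * F2' δ t * t) := by
  have key (t : ℝ) (ht : δ ≤ |t|) : 0 ≤ δ * |t| - δ^2/2 := by
    nlinarith
  refine ⟨fun t => ?_, fun t => ?_⟩
  · by_cases h : |t| < δ
    · simp only [F1, F1', h, if_true]
      nlinarith [sq_nonneg t]
    · simp only [F1, F1', h, if_false]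
      linear_combination key t (not_lt.mp h) + δ * sign_mul_self_eq_abs t
  · rcases lt_trichotomy |t| δ with h | h | h
    · simp only [F2, F2', h, h.le, if_true]
      nlinarith [sq_nonneg t]
    · have ht : t^2 = δ^2 := by rw [← h, sq_abs]
      simp only [F2, F2', h, le_refl, lt_irrefl, if_true, if_false, ht,
        div_self (pow_ne_zero 2 hδ0.ne'), Real.log_one]
      nlinarith [sq_nonneg δ]
    · simp only [F2, F2', not_lt.mpr h.le, not_le.mpr h, if_false]
      linear_combination key t h.le + δ * sign_mul_self_eq_abs t
end
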